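/- For every integer n ≥ 2 and all indices with 1 ≤ j ≤ i ≤ n−1, 1 ≤ l ≤ k ≤ n−1, j+2 ≤ k, i ≥ k and j < l, the equation h^{[i,j]} h^{[k,l]} = h^{[k−2,j]} h^{[i,l]} holds in the Kauffman monoid K_n. -/

import Mathlib

/-!
Kauffman monoid `K n` for `n ≥ 2`: presented by generators `h^1, …, h^{n-1}`
(diapsides) and `c` (circle), subject to
`h^i h^j = h^j h^i` for `|i-j| ≥ 2`, `h^i h^{i±1} h^i = h^i`,
`h^i c = c h^i`, `h^i h^i = c h^i`.
-/

namespace Kauffman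

/-- Valid diapsis indices `1 ≤ i ≤ n-1`. -/
def Idx (n : ℕ) : Type := {i : ℕ // 1 ≤ i ∧ i ≤ n - 1}

/-- Generators of the Kauffman monoid. -/
inductive Gen (n : ℕ) : Type
  | h : Idx n → Gen n
  | c : Gen n

/-- The defining relations of the Kauffman monoid. -/
inductive Rel (n : ℕ) : FreeMonoid (Gen n) → FreeMonoid (Gen n) → Prop
  | comm (i j : Idx n) (hij : i.1 + 2 ≤ j.1 ∨ j.1 + 2 ≤ i.1) :
      Rel n (FreeMonoid.of (Gen.h i) * FreeMonoid.of (Gen.h j))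
            (FreeMonoid.of (Gen.h j) * FreeMonoid.of (Gen.h i))
  | absorb (i j : Idx n) (hij : j.1 = i.1 + 1 ∨ i.1 = j.1 + 1) :
      Rel n (FreeMonoid.of (Gen.h i) * FreeMonoid.of (Gen.h j) * FreeMonoid.of (Gen.h i))
            (FreeMonoid.of (Gen.h i))
  | hc (i : Idx n) :
      Rel n (FreeMonoid.of (Gen.h i) * FreeMonoid.of Gen.c)
            (FreeMonoid.of Gen.c * FreeMonoid.of (Gen.h i))
  | hh (i : Idx n) :
      Rel n (FreeMonoid.of (Gen.h i) * FreeMonoid.of (Gen.h i))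
            (FreeMonoid.of Gen.c * FreeMonoid.of (Gen.h i))

/-- The congruence generated by the Kauffman relations. -/
def kcon (n : ℕ) : Con (FreeMonoid (Gen n)) := conGen (Rel n)

/-- The Kauffman monoid `K n`. -/
abbrev K (n : ℕ) : Type := (kcon n).Quotient

/-- The diapsis `h^i` as an element of `K n` (defined to be `1` for out-of-range `i`). -/
def hK (n i : ℕ) : K n :=
  if h : 1 ≤ i ∧ i ≤ n - 1 then ((FreeMonoid.of (Gen.h ⟨i, h⟩) : FreeMonoid (Gen n)) : K n)
  else 1

/-- The circle `c` as an element of `K n`. -/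
def cK (n : ℕ) : K n := ((FreeMonoid.of Gen.c : FreeMonoid (Gen n)) : K n)

/-- The block `h^{[i,j]} = h^i h^{i-1} ⋯ h^{j+1} h^j` (for `j ≤ i`). -/
def block (n i j : ℕ) : K n :=
  (((List.range (i + 1 - j)).map fun t => hK n (i - t))).prod

end Kauffman

namespace Kauffman

variable {n : ℕ}

theorem hK_commute {i j : ℕ} (hij : i + 2 ≤ j ∨ j + 2 ≤ i) : Commute (hK n i) (hK n j) := by
  unfold hK
  split_ifs with hi hj
  · exact (Con.eq _).2 (ConGen.Rel.of _ _ (Rel.comm ⟨i, hi⟩ ⟨j, hj⟩ hij))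
  · exact Commute.one_right _
  · exact Commute.one_left _
  · exact Commute.one_left _

theorem hK_absorb {i j : ℕ} (hi : 1 ≤ i ∧ i ≤ n - 1) (hj : 1 ≤ j ∧ j ≤ n - 1)
    (hij : j = i + 1 ∨ i = j + 1) : hK n i * hK n j * hK n i = hK n i := by
  rw [hK, dif_pos hi, hK, dif_pos hj]
  exact (Con.eq _).2 (ConGen.Rel.of _ _ (Rel.absorb ⟨i, hi⟩ ⟨j, hj⟩ hij))

theorem block_of_lt {i j : ℕ} (h : i < j) : block n i j = 1 := by
  have : i + 1 - j = 0 := by omega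
  simp [block, this]

theorem block_succ {i j : ℕ} (h : j ≤ i + 1) :
    block n (i + 1) j = hK n (i + 1) * block n i j := by
  have : i + 1 + 1 - j = (i + 1 - j) + 1 := by omega
  simp [block, this, List.range_succ_eq_map, Function.comp_def]

theorem block_self (i : ℕ) : block n i i = hK n i := by
  simp [block]

theorem block_mul_block {i m j : ℕ} (hj : j ≤ m + 1) (hm : m ≤ i) :
    block n i (m + 1) * block n m j = block n i j := by
  induction i, hm using Nat.le_induction with
  | base => rw [block_of_lt (Nat.lt_succ_self m), one_mul]
  | succ i hmi ih => rw [block_succ (by omega), block_succ (by omega), mul_assoc, ih]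

theorem commute_block {x : K n} {i j : ℕ} (h : ∀ t, j ≤ t → t ≤ i → Commute x (hK n t)) :
    Commute x (block n i j) := by
  refine Commute.list_prod_right _ _ fun y hy => ?_
  obtain ⟨t, ht, rfl⟩ := List.mem_map.1 hy
  rw [List.mem_range] at ht
  exact h _ (by omega) (by omega)

theorem hK_commute_block {k m j : ℕ} (h : m + 2 ≤ k) : Commute (hK n k) (block n m j) :=
  commute_block fun _ _ _ => hK_commute (by omega)

theorem block_commute_block {i k m j : ℕ} (h : m + 2 ≤ k) :
    Commute (block n i k) (block n m j) :=
  (commute_block fun _ _ _ => (hK_commute_block (by omega)).symm).symm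

end Kauffman

open Kauffman in
/-- `(h III.3)`: for `j+2 ≤ k`, `i ≥ k` and `j < l`,
`h^{[i,j]} h^{[k,l]} = h^{[k-2,j]} h^{[i,l]}` in `K n`. -/
theorem kauffman_block_exchange_three (n i j k l : ℕ) (hn : 2 ≤ n)
    (hj : 1 ≤ j) (hji : j ≤ i) (hi : i ≤ n - 1)
    (hl : 1 ≤ l) (hlk : l ≤ k) (hk : k ≤ n - 1)
    (hjk : j + 2 ≤ k) (hik : k ≤ i) (hjl : j < l) :
    block n i j * block n k l = block n (k - 2) j * block n i l := by
  obtain ⟨m, rfl⟩ := Nat.exists_eq_add_of_le' (show 2 ≤ k by omega)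
  have absorb : hK n (m + 2) * hK n (m + 1) * hK n (m + 2) = hK n (m + 2) :=
    hK_absorb (by omega) (by omega) (by omega)
  have left : block n i j =
      block n i (m + 2 + 1) * (hK n (m + 2) * (hK n (m + 1) * block n m j)) := by
    rw [← block_succ (by omega), ← block_succ (by omega), block_mul_block (by omega) hik]
  have right : block n i (m + 2 + 1) * hK n (m + 2) = block n i (m + 2) := by
    rw [← block_self, block_mul_block (by omega) hik]
  calc block n i j * block n (m + 2) l
      = block n i (m + 2 + 1) * (hK n (m + 2) * hK n (m + 1)) *
          (block n m j * hK n (m + 2)) * block n (m + 1) l := by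
        rw [left, block_succ hlk]; simp only [mul_assoc]
    _ = block n i (m + 2 + 1) * (hK n (m + 2) * hK n (m + 1) * hK n (m + 2)) *
          block n m j * block n (m + 1) l := by
        rw [← (hK_commute_block le_rfl).eq]; simp only [mul_assoc]
    _ = block n m j * (block n i (m + 2) * block n (m + 1) l) := by
        rw [absorb, right, (block_commute_block le_rfl).eq, mul_assoc]
    _ = block n (m + 2 - 2) j * block n i l := by
        rw [block_mul_block (by omega) (by omega), Nat.add_sub_cancel]
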